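/- arXiv:2103.01870 — 5 statements merged into one kernel-verified Lean document; each statement's English description precedes it below -/
import Mathlib

section
/- Let ρ > 0, let R' ⊆ R(ρ) be an axis-parallel rectangle, let n ≥ 1, and set Z := P(H_{R'}|η). Then for all λ > 0, Var_{R(ρ)}( e^{λZ/2} ) ≤ (λ²/4) · E_{R(ρ)}[ e^{λZ} · Σ_{j=1}^n e^{λ·Inf_j(H_{R'}|η)} · Inf_j(H_{R'}|η)² ], where the variance and expectation are with respect to the n random points. -/
open MeasureTheory Set
open scoped Classical ENNReal

namespace VoronoiTest

/-- Squared Euclidean distance between two points of the plane. -/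
def sqDist (p q : ℝ × ℝ) : ℝ := (p.1 - q.1) ^ 2 + (p.2 - q.2) ^ 2

/-- The closed axis-parallel rectangle `[x₁, x₂] × [y₁, y₂]`. -/
def rect (x₁ x₂ y₁ y₂ : ℝ) : Set (ℝ × ℝ) := Icc x₁ x₂ ×ˢ Icc y₁ y₂

/-- The Voronoi cell (inside the region `R`) of the `i`-th point of the configuration `η`:
all points of `R` that are (Euclidean-)closer to `η i` than to any other point of `η`. -/
def cell {n : ℕ} (R : Set (ℝ × ℝ)) (η : Fin n → ℝ × ℝ) (i : Fin n) : Set (ℝ × ℝ) :=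
  {p ∈ R | ∀ j : Fin n, sqDist p (η i) ≤ sqDist p (η j)}

/-- The union of the red Voronoi cells, for the colouring `c` (`true` = red). -/
def redSet {n : ℕ} (R : Set (ℝ × ℝ)) (η : Fin n → ℝ × ℝ) (c : Fin n → Bool) : Set (ℝ × ℝ) :=
  ⋃ i ∈ {i : Fin n | c i = true}, cell R η i

/-- The event `H_{R'}` that the rectangle `R' = [x₁,x₂] × [y₁,y₂]` is crossed horizontally
by a continuous path contained in the union of the red Voronoi cells. -/
def Crossing {n : ℕ} (R : Set (ℝ × ℝ)) (x₁ x₂ y₁ y₂ : ℝ)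
    (η : Fin n → ℝ × ℝ) (c : Fin n → Bool) : Prop :=
  ∃ γ : ℝ → ℝ × ℝ, ContinuousOn γ (Icc 0 1) ∧
    (∀ t ∈ Icc (0 : ℝ) 1, γ t ∈ redSet R η c ∩ rect x₁ x₂ y₁ y₂) ∧
    (γ 0).1 = x₁ ∧ (γ 1).1 = x₂

/-- The conditional probability `P(H_{R'} | η)` of a red horizontal crossing of
`R' = [x₁,x₂] × [y₁,y₂]`, given the point configuration `η`: the proportion of the `2 ^ n`
(uniformly likely) colourings that produce a red crossing. -/
noncomputable def condProb {n : ℕ} (R : Set (ℝ × ℝ)) (x₁ x₂ y₁ y₂ : ℝ)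
    (η : Fin n → ℝ × ℝ) : ℝ :=
  (Finset.univ.filter fun c : Fin n → Bool => Crossing R x₁ x₂ y₁ y₂ η c).card / 2 ^ n

/-- The conditional influence `Inf_j(H_{R'} | η)` of the `j`-th point: the probability, over a
uniform random colouring, that flipping the colour of the `j`-th point changes the occurrence
of the crossing event. -/
noncomputable def influence {n : ℕ} (R : Set (ℝ × ℝ)) (x₁ x₂ y₁ y₂ : ℝ)
    (η : Fin n → ℝ × ℝ) (j : Fin n) : ℝ :=
  (Finset.univ.filter fun c : Fin n → Bool =>
      Crossing R x₁ x₂ y₁ y₂ η c ≠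
        Crossing R x₁ x₂ y₁ y₂ η (Function.update c j (!c j))).card / 2 ^ n

/-- The uniform probability measure on the region `R ⊆ ℝ²`. -/
noncomputable def unif (R : Set (ℝ × ℝ)) : Measure (ℝ × ℝ) :=
  (volume R)⁻¹ • volume.restrict R

/-- The law of the point configuration `η` in the binomial model `P_R`:
`n` points placed independently and uniformly at random in `R`. -/
noncomputable def pts (R : Set (ℝ × ℝ)) (n : ℕ) : Measure (Fin n → ℝ × ℝ) :=
  Measure.pi fun _ => unif R

/-- The annealed probability `P_R(H_{R'})` of a red horizontal crossing of
`R' = [x₁,x₂] × [y₁,y₂]` in the binomial model on `R` with `n` points: the average of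
`P(H_{R'} | η)` over the point configuration. -/
noncomputable def annealed (R : Set (ℝ × ℝ)) (x₁ x₂ y₁ y₂ : ℝ) (n : ℕ) : ℝ :=
  ∫ η, condProb R x₁ x₂ y₁ y₂ η ∂(pts R n)

/-- The rectangle `R(ρ, s)` of aspect ratio `ρ` and area `s`, centred at the origin,
given as the 4-tuple `(x₁, x₂, y₁, y₂)` of coordinates of its sides. -/
noncomputable def Rco (ρ s : ℝ) : ℝ × ℝ × ℝ × ℝ :=
  (-(Real.sqrt (ρ * s)) / 2, Real.sqrt (ρ * s) / 2,
    -(Real.sqrt (s / ρ)) / 2, Real.sqrt (s / ρ) / 2)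

/-- The rectangle `R(ρ, s)` of aspect ratio `ρ` and area `s`, centred at the origin. -/
noncomputable def Rrect (ρ s : ℝ) : Set (ℝ × ℝ) :=
  rect (Rco ρ s).1 (Rco ρ s).2.1 (Rco ρ s).2.2.1 (Rco ρ s).2.2.2

/-- The unit square `S = [-1/2, 1/2]²`. -/
def unitSq : Set (ℝ × ℝ) := rect (-(1/2)) (1/2) (-(1/2)) (1/2)

section EfronStein

open ProbabilityTheory

variable {α β : Type*} [MeasurableSpace α] [MeasurableSpace β]

/-- The second moment dominates the square of the mean. -/
theorem sq_integral_le_integral_sq {μ : Measure α} [IsProbabilityMeasure μ] {f : α → ℝ}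
    (hf : MemLp f 2 μ) : (∫ x, f x ∂μ) ^ 2 ≤ ∫ x, f x ^ 2 ∂μ := by
  have h := variance_nonneg f μ
  rw [variance_eq_sub hf] at h
  simpa using h

/-- The variance is at most the second moment about any point. -/
theorem variance_le_integral_sub_sq {μ : Measure α} [IsProbabilityMeasure μ] {f : α → ℝ}
    (hf : Measurable f) (m : ℝ) : Var[f; μ] ≤ ∫ x, (f x - m) ^ 2 ∂μ := by
  rw [← variance_sub_const hf.aestronglyMeasurable m]
  exact variance_le_expectation_sq (hf.sub_const m).aestronglyMeasurable

theorem abs_integral_le_of_abs_le {μ : Measure α} [IsProbabilityMeasure μ] {f : α → ℝ} {C : ℝ}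
    (hC : ∀ x, |f x| ≤ C) : |∫ x, f x ∂μ| ≤ C := by
  simpa using norm_integral_le_of_norm_le_const (μ := μ) (f := f) (C := C) (ae_of_all _ hC)

theorem memLp_of_abs_le {μ : Measure α} [IsProbabilityMeasure μ] {f : α → ℝ} {C : ℝ}
    (hf : Measurable f) (hC : ∀ x, |f x| ≤ C) (p : ℝ≥0∞) : MemLp f p μ :=
  MemLp.of_bound hf.aestronglyMeasurable C (ae_of_all _ hC)

theorem integrable_of_abs_le {μ : Measure α} [IsProbabilityMeasure μ] {f : α → ℝ} {C : ℝ}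
    (hf : Measurable f) (hC : ∀ x, |f x| ≤ C) : Integrable f μ :=
  Integrable.of_bound hf.aestronglyMeasurable C (ae_of_all _ hC)

/-- Subadditivity of the variance on a product of two probability spaces. -/
theorem variance_prod_le (μ : Measure α) (ν : Measure β) [IsProbabilityMeasure μ]
    [IsProbabilityMeasure ν] {f : α × β → ℝ} {C : ℝ} (hf : Measurable f) (hC : ∀ z, |f z| ≤ C) :
    Var[f; μ.prod ν] ≤
      ∫ x, Var[fun y => f (x, y); ν] ∂μ + ∫ y, Var[fun x => f (x, y); μ] ∂ν := by
  set A : α → ℝ := fun x => ∫ y, f (x, y) ∂ν with hA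
  set B : β → ℝ := fun y => ∫ x, f (x, y) ∂μ with hB
  have hfx : ∀ x, Measurable fun y => f (x, y) := fun x => by fun_prop
  have hfy : ∀ y, Measurable fun x => f (x, y) := fun y => by fun_prop
  have hAm : Measurable A := hf.stronglyMeasurable.integral_prod_right'.measurable
  have hBm : Measurable B := hf.stronglyMeasurable.integral_prod_left'.measurable
  have hAC : ∀ x, |A x| ≤ C := fun x => abs_integral_le_of_abs_le fun y => hC (x, y)
  have hBC : ∀ y, |B y| ≤ C := fun y => abs_integral_le_of_abs_le fun x => hC (x, y)
  have sq_bound : ∀ {u K : ℝ}, |u| ≤ K → |u ^ 2| ≤ K ^ 2 := fun {u K} h => by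
    rw [abs_pow]; gcongr
  have hf2 : Integrable (fun z => f z ^ 2) (μ.prod ν) :=
    integrable_of_abs_le (hf.pow_const 2) fun z => sq_bound (hC z)
  have hfi : Integrable f (μ.prod ν) := integrable_of_abs_le hf hC
  have hdiff : ∀ z : α × β, |f z - B z.2| ≤ C + C := fun z =>
    (abs_sub _ _).trans (add_le_add (hC z) (hBC z.2))
  have hdm : Measurable fun z : α × β => f z - B z.2 := by fun_prop
  have hd2 : Integrable (fun z : α × β => (f z - B z.2) ^ 2) (μ.prod ν) :=
    integrable_of_abs_le (hdm.pow_const 2) fun z => sq_bound (hdiff z)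
  have hmean : ∫ x, A x ∂μ = ∫ z, f z ∂μ.prod ν := (integral_prod f hfi).symm
  have htotal : Var[f; μ.prod ν] = ∫ x, Var[fun y => f (x, y); ν] ∂μ + Var[A; μ] := by
    have h1 : ∀ x, Var[fun y => f (x, y); ν] = ∫ y, f (x, y) ^ 2 ∂ν - A x ^ 2 := fun x => by
      rw [variance_eq_sub (memLp_of_abs_le (hfx x) (fun y => hC (x, y)) 2)]
      simp [hA]
    rw [variance_eq_sub (memLp_of_abs_le hf hC 2), variance_eq_sub (memLp_of_abs_le hAm hAC 2),
      hmean]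
    simp_rw [h1]
    rw [integral_sub hf2.integral_prod_left
      (integrable_of_abs_le (hAm.pow_const 2) fun x => sq_bound (hAC x))]
    simp only [Pi.pow_apply]
    rw [integral_prod _ hf2]
    ring
  have hjensen : Var[A; μ] ≤ ∫ y, Var[fun x => f (x, y); μ] ∂ν := by
    have h2 : ∀ y, Var[fun x => f (x, y); μ] = ∫ x, (f (x, y) - B y) ^ 2 ∂μ := fun y =>
      variance_eq_integral (hfy y).aemeasurable
    simp_rw [h2]
    rw [variance_eq_integral hAm.aemeasurable, ← integral_prod_symm _ hd2, integral_prod _ hd2]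
    have hBmean : ∫ x, A x ∂μ = ∫ y, B y ∂ν := by
      rw [hmean, integral_prod_symm f hfi]
    refine integral_mono (integrable_of_abs_le (C := (C + C) ^ 2) (by fun_prop) fun x =>
      sq_bound ?_) hd2.integral_prod_left fun x => ?_
    · exact (abs_sub _ _).trans (add_le_add (hAC x) (abs_integral_le_of_abs_le hAC))
    · have h3 : A x - ∫ x, A x ∂μ = ∫ y, (f (x, y) - B y) ∂ν := by
        rw [hBmean, integral_sub (integrable_of_abs_le (hfx x) fun y => hC (x, y))
          (integrable_of_abs_le hBm hBC)]
      simp only [h3]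
      exact sq_integral_le_integral_sq
        (memLp_of_abs_le ((hfx x).sub hBm) (fun y => hdiff (x, y)) 2)
  linarith

/-- **Efron–Stein inequality**, where the fluctuation in the `j`-th coordinate about some value
not depending on that coordinate is controlled by `H j`. -/
theorem variance_pi_le_sum_integral (μ : Measure α) [IsProbabilityMeasure μ] :
    ∀ (n : ℕ) (f : (Fin n → α) → ℝ) (H : Fin n → (Fin n → α) → ℝ) (C : ℝ),
      Measurable f → (∀ η, |f η| ≤ C) → (∀ j, Measurable (H j)) → (∀ j η, |H j η| ≤ C) →
      (∀ j η, ∃ m, ∀ y, (f (Function.update η j y) - m) ^ 2 ≤ H j (Function.update η j y)) →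
      Var[f; Measure.pi fun _ => μ] ≤ ∑ j, ∫ η, H j η ∂Measure.pi fun _ => μ
  | 0, f, H, C, _, _, _, _, _ => by
    have hconst : f = fun _ => f default := funext fun η => congrArg f (Subsingleton.elim _ _)
    rw [hconst, variance_eq_integral aemeasurable_const]
    simp
  | n + 1, f, H, C, hf, hfC, hH, hHC, hosc => by
    set π : Measure (Fin n → α) := Measure.pi fun _ => μ with hπ
    set e := (MeasurableEquiv.piFinSuccAbove (fun _ : Fin (n + 1) => α) 0).symm with he
    have hmp : MeasurePreserving e (μ.prod π) (Measure.pi fun _ => μ) :=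
      (measurePreserving_piFinSuccAbove (fun _ : Fin (n + 1) => μ) 0).symm _
    have hcons : ∀ z, e z = Fin.cons z.1 z.2 := fun z => by
      simp [he, MeasurableEquiv.piFinSuccAbove, Fin.insertNthEquiv]
    have hcm : Measurable fun z : α × (Fin n → α) => (Fin.cons z.1 z.2 : Fin (n + 1) → α) := by
      simpa only [← hcons] using e.measurable
    have hfc : Measurable fun z : α × (Fin n → α) => f (Fin.cons z.1 z.2) := hf.comp hcm
    have hHc : ∀ j, Measurable fun z : α × (Fin n → α) => H j (Fin.cons z.1 z.2) :=
      fun j => (hH j).comp hcm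
    have hHi : ∀ j, Integrable (fun z : α × (Fin n → α) => H j (Fin.cons z.1 z.2)) (μ.prod π) :=
      fun j => integrable_of_abs_le (hHc j) fun z => hHC j _
    have hvar : Var[f; Measure.pi fun _ => μ] =
        Var[fun z : α × (Fin n → α) => f (Fin.cons z.1 z.2); μ.prod π] := by
      simp_rw [← hcons]
      exact (hmp.variance_fun_comp hf.aemeasurable).symm
    have hint : ∀ j, ∫ η, H j η ∂(Measure.pi fun _ => μ) =
        ∫ z, H j (Fin.cons z.1 z.2) ∂μ.prod π := fun j => by
      simp_rw [← hcons]
      exact (hmp.integral_comp' (H j)).symm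
    have hfirst : ∫ y, Var[fun x => f (Fin.cons x y); μ] ∂π ≤
        ∫ η, H 0 η ∂Measure.pi fun _ => μ := by
      rw [hint 0, integral_prod_symm _ (hHi 0)]
      refine integral_mono_of_nonneg (ae_of_all _ fun y => variance_nonneg _ _)
        (hHi 0).integral_prod_right (ae_of_all _ fun y => ?_)
      have hfy : Measurable fun x => f (Fin.cons x y) := by
        exact hfc.comp (measurable_id.prodMk measurable_const)
      have hHy : Measurable fun x => H 0 (Fin.cons x y) := by
        exact (hHc 0).comp (measurable_id.prodMk measurable_const)
      obtain ⟨x₀⟩ : Nonempty α := nonempty_of_isProbabilityMeasure μ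
      obtain ⟨m, hm⟩ := hosc 0 (Fin.cons x₀ y)
      simp only [Fin.update_cons_zero] at hm
      refine (variance_le_integral_sub_sq hfy m).trans ?_
      exact integral_mono_of_nonneg (ae_of_all _ fun x => sq_nonneg _)
        (integrable_of_abs_le hHy fun x => hHC 0 _) (ae_of_all _ hm)
    have hrest : ∫ x, Var[fun y => f (Fin.cons x y); π] ∂μ ≤
        ∑ j : Fin n, ∫ η, H j.succ η ∂Measure.pi fun _ => μ := by
      have hsum : ∑ j : Fin n, ∫ η, H j.succ η ∂(Measure.pi fun _ => μ) =
          ∫ x, ∑ j : Fin n, ∫ y, H j.succ (Fin.cons x y) ∂π ∂μ := by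
        rw [integral_finsetSum _ fun j _ => (hHi j.succ).integral_prod_left]
        exact Finset.sum_congr rfl fun j _ => by rw [hint, integral_prod _ (hHi j.succ)]
      rw [hsum]
      refine integral_mono_of_nonneg (ae_of_all _ fun x => variance_nonneg _ _)
        (integrable_finsetSum _ fun j _ => (hHi j.succ).integral_prod_left)
        (ae_of_all _ fun x => ?_)
      refine variance_pi_le_sum_integral μ n (fun y => f (Fin.cons x y))
        (fun j y => H j.succ (Fin.cons x y)) C (hfc.comp measurable_prodMk_left)
        (fun y => hfC _) (fun j => (hHc j.succ).comp measurable_prodMk_left)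
        (fun j y => hHC _ _) fun j y => ?_
      obtain ⟨m, hm⟩ := hosc j.succ (Fin.cons x y)
      refine ⟨m, fun z => ?_⟩
      simpa only [Fin.cons_update] using hm z
    rw [hvar, Fin.sum_univ_succ]
    have := variance_prod_le μ π hfc fun z => hfC _
    linarith

end EfronStein

section ConvexCover

variable {ι E : Type*}

/-- Points lying in sets of a chain of convex sets, consecutive ones of which intersect, are joined
in any set containing the chain. -/
theorem joinedIn_of_reflTransGen [AddCommGroup E] [Module ℝ E] [TopologicalSpace E]
    [ContinuousAdd E] [ContinuousSMul ℝ E] {S : ι → Set E} {K : Set E} {red : ι → Prop}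
    (hconv : ∀ i, Convex ℝ (S i)) (hK : ∀ i, red i → S i ⊆ K) {i k : ι} (hi : red i)
    (h : Relation.ReflTransGen (fun i k => red i ∧ red k ∧ (S i ∩ S k).Nonempty) i k)
    {x y : E} (hx : x ∈ S i) (hy : y ∈ S k) : JoinedIn K x y := by
  induction h generalizing y with
  | refl => exact (((hconv i).isPathConnected ⟨x, hx⟩).joinedIn x hx y hy).mono (hK i hi)
  | @tail m k _ hstep ih =>
    obtain ⟨_, hk, z, hzm, hzk⟩ := hstep
    exact (ih hzm).trans
      ((((hconv k).isPathConnected ⟨z, hzk⟩).joinedIn z hzk y hy).mono (hK k hk))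

/-- A connected set covered by finitely many closed sets links, through a chain of intersecting
sets of the cover, any two sets of the cover that it meets. -/
theorem reflTransGen_of_isPreconnected [Finite ι] [TopologicalSpace E] {S : ι → Set E} {red : ι → Prop}
    (hclosed : ∀ i, IsClosed (S i)) {T : Set E} (hT : IsPreconnected T)
    (hcover : ∀ p ∈ T, ∃ i, red i ∧ p ∈ S i) {i k : ι} (hi : red i) (hk : red k)
    {x y : E} (hx : x ∈ T) (hy : y ∈ T) (hxi : x ∈ S i) (hyk : y ∈ S k) :
    Relation.ReflTransGen (fun i k => red i ∧ red k ∧ (S i ∩ S k).Nonempty) i k := by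
  set r : ι → ι → Prop := fun i k => red i ∧ red k ∧ (S i ∩ S k).Nonempty
  have hcl : ∀ P : ι → Prop, IsClosed (⋃ m ∈ {m | red m ∧ P m}, S m) := fun P =>
    (Set.toFinite _).isClosed_biUnion fun m _ => hclosed m
  by_contra hik
  obtain ⟨z, _, hz, hz'⟩ := isPreconnected_closed_iff.1 hT _ _
    (hcl fun m => Relation.ReflTransGen r i m) (hcl fun m => ¬ Relation.ReflTransGen r i m)
    (fun p hp => by
      obtain ⟨m, hm, hpm⟩ := hcover p hp
      by_cases h : Relation.ReflTransGen r i m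
      · exact Or.inl (mem_biUnion (show m ∈ {m | red m ∧ _} from ⟨hm, h⟩) hpm)
      · exact Or.inr (mem_biUnion (show m ∈ {m | red m ∧ _} from ⟨hm, h⟩) hpm))
    ⟨x, hx, mem_biUnion (show i ∈ {m | red m ∧ _} from ⟨hi, .refl⟩) hxi⟩
    ⟨y, hy, mem_biUnion (show k ∈ {m | red m ∧ _} from ⟨hk, hik⟩) hyk⟩
  simp only [mem_iUnion, mem_ofPred_eq] at hz hz'
  obtain ⟨m, ⟨hm, him⟩, hzm⟩ := hz
  obtain ⟨m', ⟨hm', him'⟩, hzm'⟩ := hz'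
  exact him' (him.tail ⟨hm, hm', z, hzm, hzm'⟩)

end ConvexCover

section Measurability

variable {n : ℕ}

theorem isClosed_rect (a b c d : ℝ) : IsClosed (rect a b c d) := isClosed_Icc.prod isClosed_Icc

theorem isCompact_rect (a b c d : ℝ) : IsCompact (rect a b c d) := isCompact_Icc.prod isCompact_Icc

theorem convex_rect (a b c d : ℝ) : Convex ℝ (rect a b c d) :=
  (convex_Icc a b).prod (convex_Icc c d)

theorem continuous_sqDist : Continuous fun z : (ℝ × ℝ) × (ℝ × ℝ) => sqDist z.1 z.2 := by
  unfold sqDist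
  fun_prop

theorem convex_setOf_sqDist_le (u v : ℝ × ℝ) : Convex ℝ {p | sqDist p u ≤ sqDist p v} := by
  intro p hp q hq s t hs ht hst
  simp only [sqDist, mem_ofPred_eq, Prod.fst_add, Prod.snd_add, Prod.smul_fst, Prod.smul_snd,
    smul_eq_mul] at hp hq ⊢
  have h := add_le_add (mul_le_mul_of_nonneg_left hp hs) (mul_le_mul_of_nonneg_left hq ht)
  obtain rfl : s = 1 - t := by linarith
  linarith

theorem convex_cell {R : Set (ℝ × ℝ)} (hR : Convex ℝ R) (η : Fin n → ℝ × ℝ) (i : Fin n) :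
    Convex ℝ (cell R η i) := by
  have : cell R η i = R ∩ ⋂ j, {p | sqDist p (η i) ≤ sqDist p (η j)} := by
    ext p; simp [cell]
  rw [this]
  exact hR.inter (convex_iInter fun j => convex_setOf_sqDist_le _ _)

/-- The graph of the `i`-th Voronoi cell as a function of the configuration is closed. -/
theorem isClosed_setOf_mem_cell {R : Set (ℝ × ℝ)} (hR : IsClosed R) (i : Fin n) :
    IsClosed {z : (ℝ × ℝ) × (Fin n → ℝ × ℝ) | z.1 ∈ cell R z.2 i} := by
  have : {z : (ℝ × ℝ) × (Fin n → ℝ × ℝ) | z.1 ∈ cell R z.2 i} =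
      Prod.fst ⁻¹' R ∩ ⋂ j, {z : (ℝ × ℝ) × (Fin n → ℝ × ℝ) | sqDist z.1 (z.2 i) ≤ sqDist z.1 (z.2 j)} := by
    ext z; simp [cell]
  rw [this]
  have hcont : ∀ k, Continuous fun z : (ℝ × ℝ) × (Fin n → ℝ × ℝ) => sqDist z.1 (z.2 k) :=
    fun k => continuous_sqDist.comp (continuous_fst.prodMk (by fun_prop))
  refine (hR.preimage continuous_fst).inter (isClosed_iInter fun j =>
    isClosed_le (hcont i) (hcont j))

theorem isClosed_cell {R : Set (ℝ × ℝ)} (hR : IsClosed R) (η : Fin n → ℝ × ℝ) (i : Fin n) :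
    IsClosed (cell R η i) :=
  (isClosed_setOf_mem_cell hR i).preimage (f := fun p => (p, η)) (by fun_prop)

theorem isClosed_setOf_exists_mem {X Y : Type*} [TopologicalSpace X] [TopologicalSpace Y]
    {Q : Set X} (hQ : IsCompact Q) {F : Set (X × Y)} (hF : IsClosed F) :
    IsClosed {y | ∃ p ∈ Q, (p, y) ∈ F} := by
  have : CompactSpace Q := isCompact_iff_compactSpace.1 hQ
  have h := isClosedMap_snd_of_compactSpace (X := Q) (Y := Y) _
    (hF.preimage (f := fun z : Q × Y => (z.1.1, z.2)) (by fun_prop))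
  convert h using 1
  ext y
  simp

/-- Combinatorial form of the crossing event: a chain of red cells, consecutive ones of which
intersect inside the crossed rectangle, leads from its left side to its right side. -/
theorem crossing_iff_reflTransGen {R : Set (ℝ × ℝ)} (hRc : IsClosed R) (hRv : Convex ℝ R)
    (a b c d : ℝ) (η : Fin n → ℝ × ℝ) (col : Fin n → Bool) :
    Crossing R a b c d η col ↔ ∃ i k, col i = true ∧ col k = true ∧
      (∃ p ∈ rect a b c d, p ∈ cell R η i ∧ p.1 = a) ∧
      (∃ p ∈ rect a b c d, p ∈ cell R η k ∧ p.1 = b) ∧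
      Relation.ReflTransGen (fun i k => col i = true ∧ col k = true ∧
        ∃ p ∈ rect a b c d, p ∈ cell R η i ∧ p ∈ cell R η k) i k := by
  set S : Fin n → Set (ℝ × ℝ) := fun i => cell R η i ∩ rect a b c d with hS
  have hrel : (fun i k => col i = true ∧ col k = true ∧
      ∃ p ∈ rect a b c d, p ∈ cell R η i ∧ p ∈ cell R η k) =
      fun i k => col i = true ∧ col k = true ∧ (S i ∩ S k).Nonempty := by
    ext i k
    simp only [hS, Set.Nonempty, mem_inter_iff]
    grind
  rw [hrel]
  constructor
  · rintro ⟨γ, hγ, hmem, h0, h1⟩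
    have hcover : ∀ p ∈ γ '' Icc 0 1, ∃ i, col i = true ∧ p ∈ S i := by
      rintro _ ⟨t, ht, rfl⟩
      obtain ⟨hred, hrect⟩ := hmem t ht
      simp only [redSet, mem_iUnion, mem_ofPred_eq] at hred
      obtain ⟨i, hi, hti⟩ := hred
      exact ⟨i, hi, hti, hrect⟩
    have hm0 : γ 0 ∈ γ '' Icc (0 : ℝ) 1 := mem_image_of_mem γ (by simp)
    have hm1 : γ 1 ∈ γ '' Icc (0 : ℝ) 1 := mem_image_of_mem γ (by simp)
    obtain ⟨i, hi, hxi⟩ := hcover _ hm0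
    obtain ⟨k, hk, hyk⟩ := hcover _ hm1
    exact ⟨i, k, hi, hk, ⟨_, hxi.2, hxi.1, h0⟩, ⟨_, hyk.2, hyk.1, h1⟩,
      reflTransGen_of_isPreconnected
        (fun m => (isClosed_cell hRc η m).inter (isClosed_rect a b c d))
        (isPreconnected_Icc.image γ hγ) hcover hi hk hm0 hm1 hxi hyk⟩
  · rintro ⟨i, k, hi, -, ⟨p, hp, hpi, hpa⟩, ⟨q, hq, hqk, hqb⟩, hchain⟩
    obtain ⟨γ, hγ⟩ := joinedIn_of_reflTransGen (K := redSet R η col ∩ rect a b c d)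
      (red := fun i => col i = true)
      (fun m => (convex_cell hRv η m).inter (convex_rect a b c d))
      (fun m hm => inter_subset_inter_left _
        (subset_biUnion_of_mem (u := fun i => cell R η i) (show m ∈ {i | col i = true} from hm)))
      hi hchain ⟨hpi, hp⟩ ⟨hqk, hq⟩
    refine ⟨γ.extend, γ.continuous_extend.continuousOn, fun t ht => ?_, by simpa, by simpa⟩
    rw [γ.extend_apply ht]
    exact hγ _

theorem measurable_crossing {R : Set (ℝ × ℝ)} (hRc : IsClosed R) (hRv : Convex ℝ R)
    (a b c d : ℝ) (col : Fin n → Bool) :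
    Measurable fun η : Fin n → ℝ × ℝ => Crossing R a b c d η col := by
  have hside : ∀ i e, Measurable fun η : Fin n → ℝ × ℝ =>
      ∃ p ∈ rect a b c d, p ∈ cell R η i ∧ p.1 = e := fun i e =>
    measurableSet_setOfPred.1 (isClosed_setOf_exists_mem (isCompact_rect a b c d)
      ((isClosed_setOf_mem_cell hRc i).inter (isClosed_eq
        (f := fun z : (ℝ × ℝ) × (Fin n → ℝ × ℝ) => z.1.1) (g := fun _ => e)
        (by fun_prop) (by fun_prop)))).measurableSet
  have hmeet : ∀ i k, Measurable fun η : Fin n → ℝ × ℝ =>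
      ∃ p ∈ rect a b c d, p ∈ cell R η i ∧ p ∈ cell R η k := fun i k =>
    measurableSet_setOfPred.1 (isClosed_setOf_exists_mem (isCompact_rect a b c d)
      ((isClosed_setOf_mem_cell hRc i).inter (isClosed_setOf_mem_cell hRc k))).measurableSet
  have hchain : ∀ i k, Measurable fun η : Fin n → ℝ × ℝ =>
      Relation.ReflTransGen (fun i k => col i = true ∧ col k = true ∧
        ∃ p ∈ rect a b c d, p ∈ cell R η i ∧ p ∈ cell R η k) i k := fun i k =>
    (measurable_of_countable fun A : Fin n → Fin n → Prop => Relation.ReflTransGen A i k).comp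
      (measurable_pi_lambda _ fun i => measurable_pi_lambda _ fun k =>
        measurable_const.and (measurable_const.and (hmeet i k)))
  simp_rw [crossing_iff_reflTransGen hRc hRv]
  exact Measurable.exists fun i => Measurable.exists fun k =>
    measurable_const.and (measurable_const.and
      ((hside i a).and ((hside k b).and (hchain i k))))

theorem measurable_card_filter_div {Ω ι : Type*} [MeasurableSpace Ω] [Fintype ι]
    {P : Ω → ι → Prop} [∀ ω i, Decidable (P ω i)] (hP : ∀ i, Measurable fun ω => P ω i) (r : ℝ) :
    Measurable fun ω => ((Finset.univ.filter fun i => P ω i).card : ℝ) / r := by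
  simp_rw [Finset.card_filter, Nat.cast_sum]
  refine (Finset.measurable_sum _ fun i _ => ?_).div_const r
  simp_rw [Nat.cast_ite]
  exact Measurable.ite (measurableSet_setOfPred.2 (hP i)) measurable_const measurable_const

theorem measurable_condProb {R : Set (ℝ × ℝ)} (hRc : IsClosed R) (hRv : Convex ℝ R)
    (a b c d : ℝ) : Measurable fun η : Fin n → ℝ × ℝ => condProb R a b c d η :=
  measurable_card_filter_div (fun col => measurable_crossing hRc hRv a b c d col) _

theorem measurable_influence {R : Set (ℝ × ℝ)} (hRc : IsClosed R) (hRv : Convex ℝ R)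
    (a b c d : ℝ) (j : Fin n) :
    Measurable fun η : Fin n → ℝ × ℝ => influence R a b c d η j := by
  unfold influence
  refine measurable_card_filter_div (P := fun η col => Crossing R a b c d η col ≠
    Crossing R a b c d η (Function.update col j (!col j))) (fun col => ?_) _
  simp_rw [ne_eq, eq_iff_iff]
  exact ((measurable_crossing hRc hRv a b c d col).iff
    (measurable_crossing hRc hRv a b c d _)).not

end Measurability

section Resampling

variable {n : ℕ}

/-- The crossing event for an arbitrary set `K` in place of the union of the red cells. -/
def CrossedBy (K : Set (ℝ × ℝ)) (a b c d : ℝ) : Prop :=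
  ∃ γ : ℝ → ℝ × ℝ, ContinuousOn γ (Icc 0 1) ∧
    (∀ t ∈ Icc (0 : ℝ) 1, γ t ∈ K ∩ rect a b c d) ∧ (γ 0).1 = a ∧ (γ 1).1 = b

theorem CrossedBy.mono {K L : Set (ℝ × ℝ)} (hKL : K ⊆ L) {a b c d : ℝ}
    (h : CrossedBy K a b c d) : CrossedBy L a b c d := by
  obtain ⟨γ, hγ, hmem, h0, h1⟩ := h
  exact ⟨γ, hγ, fun t ht => ⟨hKL (hmem t ht).1, (hmem t ht).2⟩, h0, h1⟩

/-- The union of the red cells of the Voronoi tessellation of the points other than `η j`. -/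
def redSetErase (R : Set (ℝ × ℝ)) (η : Fin n → ℝ × ℝ) (col : Fin n → Bool) (j : Fin n) :
    Set (ℝ × ℝ) :=
  {p ∈ R | ∃ i ≠ j, col i = true ∧ ∀ k ≠ j, sqDist p (η i) ≤ sqDist p (η k)}

theorem redSetErase_update (R : Set (ℝ × ℝ)) (η : Fin n → ℝ × ℝ) (col : Fin n → Bool)
    (j : Fin n) (y : ℝ × ℝ) :
    redSetErase R (Function.update η j y) col j = redSetErase R η col j := by
  unfold redSetErase
  ext p
  refine and_congr_right fun _ => exists_congr fun i => and_congr_right fun hi =>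
    and_congr_right fun _ => forall₂_congr fun k hk => ?_
  rw [Function.update_of_ne hi, Function.update_of_ne hk]

theorem redSetErase_congr (R : Set (ℝ × ℝ)) (η : Fin n → ℝ × ℝ) {col col' : Fin n → Bool}
    {j : Fin n} (h : ∀ i ≠ j, col i = col' i) :
    redSetErase R η col j = redSetErase R η col' j := by
  unfold redSetErase
  ext p
  refine and_congr_right fun _ => exists_congr fun i => and_congr_right fun hi => ?_
  rw [h i hi]

theorem redSet_subset_redSetErase (R : Set (ℝ × ℝ)) (η : Fin n → ℝ × ℝ) {col : Fin n → Bool}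
    {j : Fin n} (hj : col j = false) : redSet R η col ⊆ redSetErase R η col j := by
  intro p hp
  simp only [redSet, mem_iUnion, mem_ofPred_eq] at hp
  obtain ⟨i, hi, hpR, hpi⟩ := hp
  exact ⟨hpR, i, by rintro rfl; simp_all, hi, fun k _ => hpi k⟩

theorem redSetErase_subset_redSet (R : Set (ℝ × ℝ)) (η : Fin n → ℝ × ℝ) {col : Fin n → Bool}
    {j : Fin n} (hj : col j = true) : redSetErase R η col j ⊆ redSet R η col := by
  rintro p ⟨hpR, i, -, hi, hp⟩
  simp only [redSet, mem_iUnion, mem_ofPred_eq]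
  rcases le_total (sqDist p (η i)) (sqDist p (η j)) with h | h
  · refine ⟨i, hi, hpR, fun k => ?_⟩
    rcases eq_or_ne k j with rfl | hk
    · exact h
    · exact hp k hk
  · refine ⟨j, hj, hpR, fun k => ?_⟩
    rcases eq_or_ne k j with rfl | hk
    · exact le_rfl
    · exact h.trans (hp k hk)

/-- If deleting the `j`-th point changes the occurrence of the crossing, so does flipping its
colour. -/
theorem crossing_ne_of_crossedBy_ne {R : Set (ℝ × ℝ)} {a b c d : ℝ} {η : Fin n → ℝ × ℝ}
    {col : Fin n → Bool} {j : Fin n}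
    (h : ¬ (Crossing R a b c d η col ↔ CrossedBy (redSetErase R η col j) a b c d)) :
    Crossing R a b c d η col ≠ Crossing R a b c d η (Function.update col j (!col j)) := by
  set col' := Function.update col j (!col j) with hcol'
  have herase : redSetErase R η col j = redSetErase R η col' j :=
    redSetErase_congr R η fun i hi => by simp [hcol', hi]
  have up : ∀ s : Fin n → Bool, s j = true → CrossedBy (redSetErase R η s j) a b c d →
      Crossing R a b c d η s := fun s hs => CrossedBy.mono (redSetErase_subset_redSet R η hs)
  have down : ∀ s : Fin n → Bool, s j = false → Crossing R a b c d η s →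
      CrossedBy (redSetErase R η s j) a b c d := fun s hs =>
    CrossedBy.mono (redSet_subset_redSetErase R η hs)
  intro heq
  refine h ?_
  cases hj : col j with
  | false =>
    have hj' : col' j = true := by simp [hcol', hj]
    exact ⟨down col hj, fun hc => heq ▸ up col' hj' (herase ▸ hc)⟩
  | true =>
    have hj' : col' j = false := by simp [hcol', hj]
    exact ⟨fun hc => herase ▸ down col' hj' (heq ▸ hc), up col hj⟩

/-- The conditional probability of a crossing of the tessellation with the `j`-th point deleted. -/
noncomputable def condProbErase (R : Set (ℝ × ℝ)) (a b c d : ℝ) (η : Fin n → ℝ × ℝ)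
    (j : Fin n) : ℝ :=
  (Finset.univ.filter fun col : Fin n → Bool =>
    CrossedBy (redSetErase R η col j) a b c d).card / 2 ^ n

theorem condProbErase_update (R : Set (ℝ × ℝ)) (a b c d : ℝ) (η : Fin n → ℝ × ℝ) (j : Fin n)
    (y : ℝ × ℝ) :
    condProbErase R a b c d (Function.update η j y) j = condProbErase R a b c d η j := by
  simp only [condProbErase, redSetErase_update]

theorem abs_card_filter_sub_card_filter_le {ι : Type*} [Fintype ι] {P Q S : ι → Prop}
    [DecidablePred P] [DecidablePred Q] [DecidablePred S]
    (h : ∀ i, ¬ (P i ↔ Q i) → S i) :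
    |((Finset.univ.filter P).card : ℝ) - (Finset.univ.filter Q).card| ≤
      (Finset.univ.filter S).card := by
  simp_rw [Finset.card_filter, Nat.cast_sum, ← Finset.sum_sub_distrib]
  refine (Finset.abs_sum_le_sum_abs _ _).trans (Finset.sum_le_sum fun i _ => ?_)
  have := h i
  by_cases hP : P i <;> by_cases hQ : Q i <;> by_cases hS : S i <;> simp_all

theorem abs_condProb_sub_condProbErase_le (R : Set (ℝ × ℝ)) (a b c d : ℝ)
    (η : Fin n → ℝ × ℝ) (j : Fin n) :
    |condProb R a b c d η - condProbErase R a b c d η j| ≤ influence R a b c d η j := by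
  unfold condProb condProbErase influence
  rw [← sub_div, abs_div, abs_of_pos (by positivity : (0 : ℝ) < 2 ^ n)]
  gcongr
  exact abs_card_filter_sub_card_filter_le
    (fun (col : Fin n → Bool) h => crossing_ne_of_crossedBy_ne h)

theorem card_filter_div_two_pow_mem_Icc (P : (Fin n → Bool) → Prop)
    [DecidablePred P] :
    ((Finset.univ.filter P).card : ℝ) / 2 ^ n ∈ Icc (0 : ℝ) 1 := by
  refine ⟨by positivity, div_le_one_of_le₀ ?_ (by positivity)⟩
  have h : (Finset.univ.filter P).card ≤ 2 ^ n := by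
    simpa using Finset.card_filter_le (Finset.univ : Finset (Fin n → Bool)) P
  exact_mod_cast h

theorem condProb_mem_Icc (R : Set (ℝ × ℝ)) (a b c d : ℝ) (η : Fin n → ℝ × ℝ) :
    condProb R a b c d η ∈ Icc (0 : ℝ) 1 := card_filter_div_two_pow_mem_Icc _

theorem influence_mem_Icc (R : Set (ℝ × ℝ)) (a b c d : ℝ) (η : Fin n → ℝ × ℝ) (j : Fin n) :
    influence R a b c d η j ∈ Icc (0 : ℝ) 1 := by
  unfold influence
  exact card_filter_div_two_pow_mem_Icc fun col => Crossing R a b c d η col ≠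
    Crossing R a b c d η (Function.update col j (!col j))

theorem abs_exp_sub_one_le_mul_exp (t : ℝ) : |Real.exp t - 1| ≤ |t| * Real.exp |t| := by
  have key : ∀ s : ℝ, 0 ≤ s → Real.exp s - 1 ≤ s * Real.exp s := fun s _ => by
    have h1 := Real.add_one_le_exp (-s)
    have h2 : Real.exp (-s) * Real.exp s = 1 := by rw [← Real.exp_add]; simp
    nlinarith [Real.exp_pos s]
  rcases le_total 0 t with ht | ht
  · rw [abs_of_nonneg ht, abs_of_nonneg (by linarith [Real.one_le_exp ht])]
    exact key t ht
  · rw [abs_of_nonpos ht, abs_of_nonpos (by linarith [Real.exp_le_one_iff.2 ht])]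
    nlinarith [Real.add_one_le_exp t, Real.one_le_exp (neg_nonneg.2 ht)]

theorem sq_exp_sub_exp_le {u v δ : ℝ} (h : |u - v| ≤ δ) :
    (Real.exp u - Real.exp v) ^ 2 ≤ δ ^ 2 * (Real.exp (2 * u) * Real.exp (2 * δ)) := by
  have hfac : Real.exp u - Real.exp v = -(Real.exp u * (Real.exp (v - u) - 1)) := by
    rw [Real.exp_sub]; field_simp; ring
  have h' : |v - u| ≤ δ := by rwa [abs_sub_comm]
  have hδ : 0 ≤ δ := (abs_nonneg _).trans h
  have hbound : |Real.exp (v - u) - 1| ≤ δ * Real.exp δ :=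
    (abs_exp_sub_one_le_mul_exp _).trans (by gcongr)
  calc (Real.exp u - Real.exp v) ^ 2
      = Real.exp u ^ 2 * |Real.exp (v - u) - 1| ^ 2 := by rw [hfac, sq_abs]; ring
    _ ≤ Real.exp u ^ 2 * (δ * Real.exp δ) ^ 2 := by gcongr
    _ = δ ^ 2 * (Real.exp (2 * u) * Real.exp (2 * δ)) := by
      rw [mul_comm 2 u, mul_comm 2 δ, Real.exp_mul, Real.exp_mul]
      norm_cast
      ring

end Resampling

theorem isProbabilityMeasure_unif_Rrect {ρ : ℝ} (hρ : 0 < ρ) :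
    IsProbabilityMeasure (unif (Rrect ρ 1)) := by
  have hvol : volume (Rrect ρ 1) =
      ENNReal.ofReal (Real.sqrt (ρ * 1)) * ENNReal.ofReal (Real.sqrt (1 / ρ)) := by
    rw [Rrect, rect, Measure.volume_eq_prod, Measure.prod_prod, Real.volume_Icc, Real.volume_Icc]
    simp only [Rco]
    congr 2 <;> ring
  constructor
  rw [unif, Measure.smul_apply, Measure.restrict_apply_univ, smul_eq_mul]
  refine ENNReal.inv_mul_cancel ?_ ?_ <;> rw [hvol]
  · have h1 : 0 < Real.sqrt (ρ * 1) := by positivity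
    have h2 : 0 < Real.sqrt (1 / ρ) := by positivity
    exact mul_ne_zero (ENNReal.ofReal_pos.2 h1).ne' (ENNReal.ofReal_pos.2 h2).ne'
  · exact ENNReal.mul_ne_top ENNReal.ofReal_ne_top ENNReal.ofReal_ne_top

/-- For `Z := P(H_{R'} | η)` and any `λ > 0`,
`Var(e^(λZ/2)) ≤ (λ²/4) E[e^(λZ) Σ_j e^(λ Inf_j) Inf_j²]`, where variance and expectation are
over the `n` uniform random points in `R(ρ)`. -/
theorem variance_mgf_bound (ρ : ℝ) (hρ : 0 < ρ)
    (a b c d : ℝ) (hab : a ≤ b) (hcd : c ≤ d) (hsub : rect a b c d ⊆ Rrect ρ 1)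
    (n : ℕ) (hn : 1 ≤ n) (l : ℝ) (hl : 0 < l) :
    ProbabilityTheory.variance
        (fun η : Fin n → ℝ × ℝ => Real.exp (l * condProb (Rrect ρ 1) a b c d η / 2))
        (pts (Rrect ρ 1) n)
      ≤ l ^ 2 / 4 *
        ∫ η, Real.exp (l * condProb (Rrect ρ 1) a b c d η) *
            ∑ j : Fin n, Real.exp (l * influence (Rrect ρ 1) a b c d η j) *
              influence (Rrect ρ 1) a b c d η j ^ 2 ∂(pts (Rrect ρ 1) n) := by
  have := isProbabilityMeasure_unif_Rrect hρ
  set R := Rrect ρ 1 with hR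
  have hRc : IsClosed R := isClosed_rect _ _ _ _
  have hRv : Convex ℝ R := convex_rect _ _ _ _
  have hZ := fun η : Fin n → ℝ × ℝ => condProb_mem_Icc R a b c d η
  have hI := fun (η : Fin n → ℝ × ℝ) (j : Fin n) => influence_mem_Icc R a b c d η j
  have hZm := measurable_condProb (n := n) hRc hRv a b c d
  have hIm := measurable_influence (n := n) hRc hRv a b c d
  set H : Fin n → (Fin n → ℝ × ℝ) → ℝ := fun j η =>
    l ^ 2 / 4 * (Real.exp (l * condProb R a b c d η) *
      (Real.exp (l * influence R a b c d η j) * influence R a b c d η j ^ 2)) with hH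
  have hHm : ∀ j, Measurable (H j) := fun j => by
    have := hIm j
    fun_prop
  have hHC : ∀ j η, |H j η| ≤ l ^ 2 / 4 * (Real.exp l * (Real.exp l * 1)) := fun j η => by
    have hZη := hZ η
    have hIη := hI η j
    rw [abs_of_nonneg (by positivity)]
    simp only [hH]
    gcongr
    · nlinarith [hZη.2]
    · nlinarith [hIη.2]
    · exact pow_le_one₀ hIη.1 hIη.2
  have hfC : ∀ η : Fin n → ℝ × ℝ, |Real.exp (l * condProb R a b c d η / 2)| ≤ Real.exp l :=
    fun η => by
      rw [abs_of_pos (Real.exp_pos _)]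
      gcongr
      nlinarith [(hZ η).1, (hZ η).2]
  have hES := variance_pi_le_sum_integral (unif R) n
    (fun η => Real.exp (l * condProb R a b c d η / 2)) H
    (max (Real.exp l) (l ^ 2 / 4 * (Real.exp l * (Real.exp l * 1)))) (by fun_prop)
    (fun η => (hfC η).trans (le_max_left _ _)) hHm
    (fun j η => (hHC j η).trans (le_max_right _ _)) fun j η => by
      refine ⟨Real.exp (l * condProbErase R a b c d η j / 2), fun y => ?_⟩
      rw [← condProbErase_update R a b c d η j y]
      set η' := Function.update η j y
      have hdist : |l * condProb R a b c d η' / 2 - l * condProbErase R a b c d η' j / 2| ≤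
          l * influence R a b c d η' j / 2 := by
        rw [← sub_div, ← mul_sub, abs_div, abs_mul, abs_of_pos hl, abs_two]
        gcongr
        exact abs_condProb_sub_condProbErase_le R a b c d η' j
      refine (sq_exp_sub_exp_le hdist).trans_eq ?_
      simp only [hH]
      rw [mul_div_cancel₀ _ two_ne_zero, mul_div_cancel₀ _ two_ne_zero]
      ring
  refine hES.trans_eq ?_
  rw [pts, ← integral_finsetSum _ fun j _ => integrable_of_abs_le (hHm j) (hHC j),
    ← integral_const_mul]
  simp only [hH, Finset.mul_sum]

end VoronoiTest
end

section
/- For every real c with 0 < c ≤ 1/4, the infinite product Π_{j=0}^∞ (1 − c·4^{−j})^{−2^j} converges and is at most 16/9, in particular at most 2. -/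
open MeasureTheory Set
open scoped ENNReal


/-- The partial products of `(1 - c·4^(-j))^(2^j)` up to `j = n` are at least
`(1 - c) * (1 - c + c / 2 ^ n)`. -/
lemma le_prod_range_one_sub_div_pow {c : ℝ} (hc : 0 ≤ c) (hc' : c ≤ 1) (n : ℕ) :
    (1 - c) * (1 - c + c / 2 ^ n) ≤
      ∏ j ∈ Finset.range (n + 1), (1 - c / 4 ^ j) ^ (2 ^ j : ℕ) := by
  induction n with
  | zero => simp
  | succ n ih =>
    rw [Finset.prod_range_succ]
    have h2 : (1 : ℝ) ≤ 2 ^ (n + 1) := one_le_pow₀ (by norm_num)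
    have hB0 : 0 ≤ c / 2 ^ (n + 1) := by positivity
    have hB1 : c / 2 ^ (n + 1) ≤ 1 := (div_le_self hc h2).trans hc'
    have hx : c / 4 ^ (n + 1) ≤ 1 :=
      (div_le_self hc (one_le_pow₀ (by norm_num))).trans hc'
    have bernoulli : 1 - c / 2 ^ (n + 1) ≤ (1 - c / 4 ^ (n + 1)) ^ (2 ^ (n + 1) : ℕ) := by
      have h := one_add_mul_le_pow (a := -(c / 4 ^ (n + 1))) (by linarith) (2 ^ (n + 1))
      have e : ((2 ^ (n + 1) : ℕ) : ℝ) * -(c / 4 ^ (n + 1)) = -(c / 2 ^ (n + 1)) := by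
        rw [show (4 : ℝ) = 2 * 2 by norm_num, mul_pow]
        push_cast
        field_simp
      rw [e] at h
      simpa only [sub_eq_add_neg] using h
    have e : c / 2 ^ n = 2 * (c / 2 ^ (n + 1)) := by
      rw [pow_succ]
      field_simp
    have hA : 2 * (c / 2 ^ (n + 1)) ≤ c := e ▸ div_le_self hc (one_le_pow₀ (by norm_num))
    rw [e] at ih
    refine le_trans ?_ (mul_le_mul ih bernoulli (by linarith) (le_trans ?_ ih))
    · rw [mul_assoc]
      refine mul_le_mul_of_nonneg_left ?_ (by linarith)
      nlinarith
    · exact mul_nonneg (by linarith) (by linarith)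

/-- A sequence of reals that are at least `1`, with bounded partial products, is multipliable. -/
lemma Real.multipliable_of_prod_range_le {f : ℕ → ℝ} {b : ℝ} (hf : ∀ j, 1 ≤ f j)
    (hb : ∀ n, ∏ j ∈ Finset.range n, f j ≤ b) : Multipliable f := by
  have hpos : ∀ j, 0 < f j := fun j => one_pos.trans_le (hf j)
  refine Real.multipliable_of_summable_log hpos ?_
  refine summable_of_sum_range_le (c := Real.log b) (fun j => Real.log_nonneg (hf j)) fun n => ?_
  rw [← Real.log_prod fun j _ => (hpos j).ne']
  exact Real.log_le_log (Finset.prod_pos fun j _ => hpos j) (hb n)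

/-- For `0 < c ≤ 1/4` the infinite product `Π_{j≥0} (1 - c·4^(-j))^(-2^j)`
converges, and its value is at most `16/9`; in particular it is at most `2`. -/
theorem infinite_product_bound (c : ℝ) (hc : 0 < c) (hc' : c ≤ 1/4) :
    Multipliable (fun j : ℕ => ((1 : ℝ) - c / 4 ^ j) ^ (-(2 ^ j : ℤ))) ∧
      (∏' j : ℕ, ((1 : ℝ) - c / 4 ^ j) ^ (-(2 ^ j : ℤ))) ≤ 16 / 9 ∧
      (∏' j : ℕ, ((1 : ℝ) - c / 4 ^ j) ^ (-(2 ^ j : ℤ))) ≤ 2 := by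
  have hx : ∀ j : ℕ, 0 < 1 - c / 4 ^ j := fun j => by
    have : c / 4 ^ j ≤ c := div_le_self hc.le (one_le_pow₀ (by norm_num))
    linarith
  have hinv : ∀ j : ℕ, (1 - c / 4 ^ j) ^ (-(2 ^ j : ℤ)) =
      ((1 - c / 4 ^ j) ^ (2 ^ j : ℕ))⁻¹ := fun j => by
    rw [zpow_neg, ← zpow_natCast]
    rfl
  have hone : ∀ j : ℕ, 1 ≤ (1 - c / 4 ^ j) ^ (-(2 ^ j : ℤ)) := fun j => by
    rw [hinv]
    refine (one_le_inv₀ (pow_pos (hx j) _)).2 (pow_le_one₀ (hx j).le ?_)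
    have : 0 ≤ c / 4 ^ j := by positivity
    linarith
  have hbound : ∀ n, ∏ j ∈ Finset.range n, (1 - c / 4 ^ j) ^ (-(2 ^ j : ℤ)) ≤ 16 / 9 := by
    rintro (_ | n)
    · norm_num
    · simp only [hinv]
      rw [Finset.prod_inv_distrib]
      refine inv_le_of_inv_le₀ (by norm_num) ?_
      refine le_trans ?_ (le_prod_range_one_sub_div_pow hc.le (by linarith) n)
      have : 0 ≤ c / 2 ^ n := by positivity
      nlinarith
  have hm := Real.multipliable_of_prod_range_le hone hbound
  have hle := hm.tprod_le_of_prod_range_le hbound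
  exact ⟨hm, hle, hle.trans (by norm_num)⟩
end

section
/- Let a > 0 and Λ > 0 satisfy aΛ² < 1, and let F : (0, Λ] → (0, ∞) be a function such that F(λ) ≤ F(λ/2)² · (1 − aλ²)^{−1} for all λ ∈ (0, Λ], and such that for each λ ∈ (0, Λ], 2^m · log F(λ·2^{−m}) → 0 as m → ∞. Then for all λ ∈ (0, Λ], F(λ) ≤ Π_{j=0}^∞ (1 − aλ²·4^{−j})^{−2^j}. -/
open MeasureTheory Set
open scoped ENNReal


lemma one_sub_div_four_pow_pos {x : ℝ} (hx0 : 0 ≤ x) (hx1 : x < 1) (j : ℕ) :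
    0 < 1 - x / 4 ^ j := by
  have : x / 4 ^ j ≤ x := div_le_self hx0 (one_le_pow₀ (by norm_num))
  linarith

lemma neg_log_one_sub_div_four_pow_le {x : ℝ} (hx0 : 0 ≤ x) (hx1 : x < 1) (j : ℕ) :
    -Real.log (1 - x / 4 ^ j) ≤ x / (1 - x) / 4 ^ j := by
  have hpos := one_sub_div_four_pow_pos hx0 hx1 j
  have hle : x / 4 ^ j ≤ x := div_le_self hx0 (one_le_pow₀ (by norm_num))
  have hlog := Real.one_sub_inv_le_log_of_pos hpos
  calc
    -Real.log (1 - x / 4 ^ j) ≤ (1 - x / 4 ^ j)⁻¹ - 1 := by linarith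
    _ = x / 4 ^ j / (1 - x / 4 ^ j) := by
      rw [eq_div_iff hpos.ne', sub_mul, inv_mul_cancel₀ hpos.ne']
      ring
    _ ≤ x / 4 ^ j / (1 - x) :=
      div_le_div_of_nonneg_left (by positivity) (by linarith) (by linarith)
    _ = x / (1 - x) / 4 ^ j := div_right_comm _ _ _

lemma multipliable_one_sub_div_four_pow_zpow {x : ℝ} (hx0 : 0 ≤ x) (hx1 : x < 1) :
    Multipliable fun j : ℕ => (1 - x / 4 ^ j) ^ (-(2 ^ j : ℤ)) := by
  have hsum : Summable fun j : ℕ => Real.log ((1 - x / 4 ^ j) ^ (-(2 ^ j : ℤ))) := by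
    refine Summable.of_nonneg_of_le (fun j => ?_) (fun j => ?_)
      (summable_geometric_two.mul_left (x / (1 - x)))
    · have hlog : Real.log (1 - x / 4 ^ j) ≤ 0 :=
        Real.log_nonpos (one_sub_div_four_pow_pos hx0 hx1 j).le
          (sub_le_self _ (by positivity))
      rw [Real.log_zpow]
      push_cast
      exact mul_nonneg_of_nonpos_of_nonpos (neg_nonpos.2 (by positivity)) hlog
    · rw [Real.log_zpow]
      push_cast
      calc
        -2 ^ j * Real.log (1 - x / 4 ^ j) = 2 ^ j * -Real.log (1 - x / 4 ^ j) := by ring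
        _ ≤ 2 ^ j * (x / (1 - x) / 4 ^ j) := by
          gcongr
          exact neg_log_one_sub_div_four_pow_le hx0 hx1 j
        _ = x / (1 - x) * (1 / 2) ^ j := by
          rw [show (4 : ℝ) = 2 * 2 by norm_num, mul_pow, one_div, inv_pow]
          field_simp
  refine hsum.hasSum.rexp.multipliable.congr fun j => ?_
  exact Real.exp_log (zpow_pos (one_sub_div_four_pow_pos hx0 hx1 j) _)

lemma mul_sq_lt_one_of_mem_Ioc {a l Λ : ℝ} (ha : 0 < a) (haΛ : a * Λ ^ 2 < 1)
    (hl : l ∈ Ioc (0 : ℝ) Λ) : a * l ^ 2 < 1 := by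
  refine lt_of_le_of_lt ?_ haΛ
  have := hl.1
  gcongr
  exact hl.2

lemma div_two_pow_mem_Ioc {l Λ : ℝ} (hl : l ∈ Ioc (0 : ℝ) Λ) (m : ℕ) :
    l / 2 ^ m ∈ Ioc (0 : ℝ) Λ :=
  ⟨div_pos hl.1 (by positivity),
    (div_le_self hl.1.le (one_le_pow₀ (by norm_num))).trans hl.2⟩

lemma le_pow_mul_prod_of_le_sq_mul {a Λ : ℝ} (ha : 0 < a) (haΛ : a * Λ ^ 2 < 1)
    {F : ℝ → ℝ} (hFpos : ∀ l ∈ Ioc (0 : ℝ) Λ, 0 < F l)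
    (hFrec : ∀ l ∈ Ioc (0 : ℝ) Λ, F l ≤ F (l / 2) ^ 2 * (1 - a * l ^ 2)⁻¹)
    {l : ℝ} (hl : l ∈ Ioc (0 : ℝ) Λ) (m : ℕ) :
    F l ≤ F (l / 2 ^ m) ^ 2 ^ m *
      ∏ j ∈ Finset.range m, ((1 : ℝ) - a * l ^ 2 / 4 ^ j) ^ (-(2 ^ j : ℤ)) := by
  have hx1 : a * l ^ 2 < 1 := mul_sq_lt_one_of_mem_Ioc ha haΛ hl
  have hx0 : 0 ≤ a * l ^ 2 := by positivity
  induction m with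
  | zero => simp
  | succ m ih =>
    have hmem := div_two_pow_mem_Ioc hl m
    have hsq : a * (l / 2 ^ m) ^ 2 = a * l ^ 2 / 4 ^ m := by
      rw [div_pow, ← pow_mul, mul_comm m 2, pow_mul, mul_div_assoc]
      norm_num
    have hstep := hFrec _ hmem
    rw [hsq, div_div, ← pow_succ] at hstep
    have hP : 0 ≤ ∏ j ∈ Finset.range m, (1 - a * l ^ 2 / 4 ^ j) ^ (-(2 ^ j : ℤ)) :=
      Finset.prod_nonneg fun j _ => (zpow_pos (one_sub_div_four_pow_pos hx0 hx1 j) _).le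
    have hz : ((1 : ℝ) - a * l ^ 2 / 4 ^ m) ^ (-(2 ^ m : ℤ)) =
        (1 - a * l ^ 2 / 4 ^ m)⁻¹ ^ 2 ^ m := by
      rw [zpow_neg, inv_pow, ← zpow_natCast]
      push_cast
      rfl
    calc
      F l ≤ _ := ih
      _ ≤ (F (l / 2 ^ (m + 1)) ^ 2 * (1 - a * l ^ 2 / 4 ^ m)⁻¹) ^ 2 ^ m * _ :=
        mul_le_mul_of_nonneg_right (pow_le_pow_left₀ (hFpos _ hmem).le hstep _) hP
      _ = _ := by
        rw [Finset.prod_range_succ, hz, mul_pow, ← pow_mul, ← pow_succ']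
        ring

/-- If `a, Λ > 0` with `aΛ² < 1`, and `F` is positive on `(0, Λ]`, satisfies
`F(λ) ≤ F(λ/2)² (1 - aλ²)⁻¹` there, and `2^m log F(λ 2^(-m)) → 0` for each such `λ`, then
`F(λ) ≤ Π_{j≥0} (1 - aλ² 4^(-j))^(-2^j)` for all `λ ∈ (0, Λ]`. -/
theorem iterated_mgf_bound (a Λ : ℝ) (ha : 0 < a) (hΛ : 0 < Λ) (haΛ : a * Λ ^ 2 < 1)
    (F : ℝ → ℝ) (hFpos : ∀ l ∈ Ioc (0 : ℝ) Λ, 0 < F l)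
    (hFrec : ∀ l ∈ Ioc (0 : ℝ) Λ, F l ≤ F (l / 2) ^ 2 * (1 - a * l ^ 2)⁻¹)
    (hFlim : ∀ l ∈ Ioc (0 : ℝ) Λ,
      Filter.Tendsto (fun m : ℕ => (2 : ℝ) ^ m * Real.log (F (l / 2 ^ m)))
        Filter.atTop (nhds 0)) :
    ∀ l ∈ Ioc (0 : ℝ) Λ,
      F l ≤ ∏' j : ℕ, ((1 : ℝ) - a * l ^ 2 / 4 ^ j) ^ (-(2 ^ j : ℤ)) := by
  intro l hl
  have hx1 : a * l ^ 2 < 1 := mul_sq_lt_one_of_mem_Ioc ha haΛ hl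
  have hprod := (multipliable_one_sub_div_four_pow_zpow (x := a * l ^ 2) (by positivity)
    hx1).hasProd.tendsto_prod_nat
  have hpow : Filter.Tendsto (fun m : ℕ => F (l / 2 ^ m) ^ 2 ^ m) Filter.atTop (nhds 1) := by
    have hexp := (Real.continuous_exp.tendsto 0).comp (hFlim l hl)
    rw [Real.exp_zero] at hexp
    refine hexp.congr fun m => ?_
    have hpos := hFpos _ (div_two_pow_mem_Ioc hl m)
    rw [Function.comp_apply, ← Real.exp_log (pow_pos hpos (2 ^ m)), Real.log_pow]
    push_cast
    rfl
  have hlim := hpow.mul hprod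
  rw [one_mul] at hlim
  exact ge_of_tendsto' hlim (le_pow_mul_prod_of_le_sq_mul ha haΛ hFpos hFrec hl)
end

section
/- For every integer n ≥ 1 and every integer m with 0 ≤ m ≤ n, the binomial probability satisfies C(n,m)·2^{−n} ≤ 2 · e^{−n/2}·(n/2)^m/m!, i.e. the ratio of the Binomial(n, 1/2) probability mass at m to the Poisson(n/2) probability mass at m is at most 2. -/
open MeasureTheory Set
open scoped ENNReal

/-- The Poisson weight `x ^ k / k!` is largest at `k = j` when `j ≤ x ≤ j + 1`. -/
theorem pow_div_factorial_le_of_mem_Icc {x : ℝ} {j : ℕ} (hx : x ∈ Icc (j : ℝ) (j + 1)) (k : ℕ) :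
    x ^ k / (k.factorial : ℝ) ≤ x ^ j / (j.factorial : ℝ) := by
  obtain ⟨hjx, hxj⟩ := hx
  have hx0 : 0 ≤ x := (Nat.cast_nonneg j).trans hjx
  have hsucc (i : ℕ) : x ^ (i + 1) / ((i + 1).factorial : ℝ) =
      x ^ i / (i.factorial : ℝ) * (x / (i + 1)) := by
    rw [Nat.factorial_succ]
    push_cast
    field_simp
    ring
  rcases le_total j k with h | h
  · induction k, h using Nat.le_induction with
    | base => exact le_rfl
    | succ i hi ih =>
      refine le_trans ?_ ih
      rw [hsucc]
      have hji : (j : ℝ) ≤ i := by exact_mod_cast hi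
      exact mul_le_of_le_one_right (by positivity)
        ((div_le_one (by positivity)).2 (by linarith))
  · induction h using Nat.decreasingInduction with
    | self => exact le_rfl
    | of_succ i hi ih =>
      refine le_trans ?_ ih
      rw [hsucc]
      have hij : (i : ℝ) + 1 ≤ j := by exact_mod_cast hi
      exact le_mul_of_one_le_right (by positivity)
        ((one_le_div (by positivity)).2 (by linarith))

theorem exp_one_mul_pow_le_pow (j : ℕ) :
    Real.exp 1 * (2 * (j : ℝ) + 1) ^ (j + 1) ≤ (2 * (j : ℝ) + 3) ^ (j + 1) := by
  have hlog := Real.le_log_one_add_of_nonneg (x := 2 / (2 * (j : ℝ) + 1)) (by positivity)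
  have hlog' : 1 ≤ ((j + 1 : ℕ) : ℝ) * Real.log (1 + 2 / (2 * (j : ℝ) + 1)) := by
    calc (1 : ℝ) = ((j + 1 : ℕ) : ℝ) *
          (2 * (2 / (2 * (j : ℝ) + 1)) / (2 / (2 * (j : ℝ) + 1) + 2)) := by
          push_cast
          field_simp
          ring
      _ ≤ _ := by gcongr
  have hexp : Real.exp 1 ≤ (1 + 2 / (2 * (j : ℝ) + 1)) ^ (j + 1) := by
    rw [← Real.log_pow] at hlog'
    exact (Real.le_log_iff_exp_le (by positivity)).1 hlog'
  calc Real.exp 1 * (2 * (j : ℝ) + 1) ^ (j + 1)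
      ≤ (1 + 2 / (2 * (j : ℝ) + 1)) ^ (j + 1) * (2 * (j : ℝ) + 1) ^ (j + 1) := by gcongr
    _ = (2 * (j : ℝ) + 3) ^ (j + 1) := by
      rw [← mul_pow]
      congr 1
      field_simp
      ring

theorem factorial_two_mul_mul_exp_le (j : ℕ) :
    ((2 * j).factorial : ℝ) * Real.exp j ≤
      (2 * (j : ℝ) + 1) ^ j * 2 ^ j * (j.factorial : ℝ) := by
  induction j with
  | zero => simp
  | succ j ih =>
    have hfac : ((2 * (j + 1)).factorial : ℝ) =
        (2 * (j : ℝ) + 2) * ((2 * (j : ℝ) + 1) * ((2 * j).factorial : ℝ)) := by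
      rw [show 2 * (j + 1) = 2 * j + 1 + 1 by ring, Nat.factorial_succ, Nat.factorial_succ]
      push_cast
      ring
    rw [hfac, Nat.factorial_succ]
    push_cast
    rw [Real.exp_add]
    calc (2 * (j : ℝ) + 2) * ((2 * (j : ℝ) + 1) * ((2 * j).factorial : ℝ)) *
          (Real.exp j * Real.exp 1)
        = (2 * (j : ℝ) + 2) * (2 * (j : ℝ) + 1) * Real.exp 1 *
          (((2 * j).factorial : ℝ) * Real.exp j) := by ring
      _ ≤ (2 * (j : ℝ) + 2) * (2 * (j : ℝ) + 1) * Real.exp 1 *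
          ((2 * (j : ℝ) + 1) ^ j * 2 ^ j * (j.factorial : ℝ)) := by gcongr
      _ = (Real.exp 1 * (2 * (j : ℝ) + 1) ^ (j + 1)) *
          (2 ^ (j + 1) * (((j : ℝ) + 1) * (j.factorial : ℝ))) := by ring
      _ ≤ (2 * (j : ℝ) + 3) ^ (j + 1) *
          (2 ^ (j + 1) * (((j : ℝ) + 1) * (j.factorial : ℝ))) :=
        mul_le_mul_of_nonneg_right (exp_one_mul_pow_le_pow j) (by positivity)
      _ = _ := by ring

theorem two_mul_add_one_pow_le (j : ℕ) :
    (2 * (j : ℝ) + 1) ^ j ≤ Real.exp (1 / 2) * (2 * (j : ℝ)) ^ j := by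
  rcases Nat.eq_zero_or_pos j with rfl | hj
  · simp
  have hj' : (0 : ℝ) < j := by exact_mod_cast hj
  have hexp : Real.exp (1 / 2) = Real.exp (1 / (2 * j)) ^ j := by
    rw [← Real.exp_nat_mul]
    congr 1
    field_simp
  rw [hexp, ← mul_pow]
  gcongr
  calc 2 * (j : ℝ) + 1 = (1 / (2 * j) + 1) * (2 * j) := by field_simp; ring
    _ ≤ _ := by gcongr; exact Real.add_one_le_exp _

theorem factorial_mul_exp_half_mul_pow_div_factorial_le (n k : ℕ) :
    (n.factorial : ℝ) * Real.exp ((n : ℝ) / 2) * (((n : ℝ) / 2) ^ k / (k.factorial : ℝ)) ≤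
      Real.exp (1 / 2) * (n : ℝ) ^ n := by
  obtain ⟨j, rfl | rfl⟩ := Nat.even_or_odd' n
  · have hhalf : ((2 * j : ℕ) : ℝ) / 2 = j := by push_cast; ring
    rw [hhalf]
    calc ((2 * j).factorial : ℝ) * Real.exp j * ((j : ℝ) ^ k / (k.factorial : ℝ))
        ≤ (2 * (j : ℝ) + 1) ^ j * 2 ^ j * (j.factorial : ℝ) *
          ((j : ℝ) ^ j / (j.factorial : ℝ)) :=
        mul_le_mul (factorial_two_mul_mul_exp_le j)
          (pow_div_factorial_le_of_mem_Icc ⟨le_rfl, by linarith⟩ k)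
          (by positivity) (by positivity)
      _ = (2 * (j : ℝ) + 1) ^ j * (2 * (j : ℝ)) ^ j := by rw [mul_pow]; field_simp
      _ ≤ Real.exp (1 / 2) * (2 * (j : ℝ)) ^ j * (2 * (j : ℝ)) ^ j :=
        mul_le_mul_of_nonneg_right (two_mul_add_one_pow_le j) (by positivity)
      _ = _ := by push_cast; ring
  · have hhalf : ((2 * j + 1 : ℕ) : ℝ) / 2 = j + 1 / 2 := by push_cast; ring
    rw [hhalf, Real.exp_add, Nat.factorial_succ]
    push_cast
    calc (2 * (j : ℝ) + 1) * ((2 * j).factorial : ℝ) * (Real.exp j * Real.exp (1 / 2)) *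
          (((j : ℝ) + 1 / 2) ^ k / (k.factorial : ℝ))
        = (2 * (j : ℝ) + 1) * Real.exp (1 / 2) * ((((2 * j).factorial : ℝ) * Real.exp j) *
          (((j : ℝ) + 1 / 2) ^ k / (k.factorial : ℝ))) := by ring
      _ ≤ (2 * (j : ℝ) + 1) * Real.exp (1 / 2) *
          ((2 * (j : ℝ) + 1) ^ j * 2 ^ j * (j.factorial : ℝ) *
          (((j : ℝ) + 1 / 2) ^ j / (j.factorial : ℝ))) :=
        mul_le_mul_of_nonneg_left
          (mul_le_mul (factorial_two_mul_mul_exp_le j)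
            (pow_div_factorial_le_of_mem_Icc ⟨by linarith, by linarith⟩ k)
            (by positivity) (by positivity)) (by positivity)
      _ = (2 * (j : ℝ) + 1) * Real.exp (1 / 2) *
          ((2 * (j : ℝ) + 1) ^ j * (2 * ((j : ℝ) + 1 / 2)) ^ j) := by
        rw [mul_pow 2]; field_simp
      _ = _ := by
        rw [show 2 * ((j : ℝ) + 1 / 2) = 2 * j + 1 by ring]
        ring

theorem exp_half_le_two : Real.exp (1 / 2) ≤ 2 := by
  rw [← Real.le_log_iff_exp_le two_pos]
  linarith [Real.log_two_gt_d9]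

/-- For `n ≥ 1` and `0 ≤ m ≤ n`, the `Binomial(n, 1/2)` mass at `m` is at
most twice the `Poisson(n/2)` mass at `m`. -/
theorem binomial_le_two_poisson (n m : ℕ) (hn : 1 ≤ n) (hm : m ≤ n) :
    (n.choose m : ℝ) / 2 ^ n ≤
      2 * (Real.exp (-(n : ℝ) / 2) * ((n : ℝ) / 2) ^ m / (m.factorial : ℝ)) := by
  have hn' : (0 : ℝ) < n := by exact_mod_cast hn
  obtain ⟨k, rfl⟩ := Nat.exists_eq_add_of_le hm
  have hchoose : ((m + k).choose m : ℝ) =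
      ((m + k).factorial : ℝ) / ((m.factorial : ℝ) * (k.factorial : ℝ)) := by
    rw [Nat.cast_choose ℝ hm, Nat.add_sub_cancel_left]
  have hbound := (factorial_mul_exp_half_mul_pow_div_factorial_le (m + k) k).trans
    (mul_le_mul_of_nonneg_right exp_half_le_two (by positivity))
  rw [hchoose, neg_div, Real.exp_neg]
  generalize ((m + k : ℕ) : ℝ) = x at hn' hbound ⊢
  have hE := Real.exp_pos (x / 2)
  generalize Real.exp (x / 2) = E at hE hbound ⊢
  generalize ((m + k).factorial : ℝ) = N at hbound ⊢
  have hmf : (0 : ℝ) < m.factorial := by positivity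
  calc N / (m.factorial * k.factorial) / 2 ^ (m + k)
      = N * E * ((x / 2) ^ k / k.factorial) *
          (1 / (m.factorial * E * 2 ^ m * 2 ^ k * (x / 2) ^ k)) := by
        field_simp
        ring
    _ ≤ 2 * x ^ (m + k) * (1 / (m.factorial * E * 2 ^ m * 2 ^ k * (x / 2) ^ k)) :=
        mul_le_mul_of_nonneg_right hbound (by positivity)
    _ = _ := by
        rw [div_pow, div_pow, pow_add]
        field_simp
end

section
/- For every integer n ≥ 1, every real a with 0 < a ≤ √n/6, and every integer m with 0 ≤ m ≤ n and |m − n/2| ≤ a√n, one has C(n,m)·2^{−n} ≥ (√(2π)/e)·e^{−3a²} · e^{−n/2}·(n/2)^m/m!; in particular the ratio of the Binomial(n, 1/2) probability mass at m to the Poisson(n/2) probability mass at m is at least (1/2)·e^{−3a²}. -/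
open MeasureTheory Set
open scoped ENNReal


/-- The upper Stirling bound `k! ≤ e √k (k/e)^k`. -/
theorem factorial_le_exp_one_mul_sqrt_mul_pow {k : ℕ} (hk : k ≠ 0) :
    (k.factorial : ℝ) ≤ Real.exp 1 * Real.sqrt k * (k / Real.exp 1) ^ k := by
  obtain ⟨j, rfl⟩ := Nat.exists_eq_succ_of_ne_zero hk
  have h : Stirling.stirlingSeq (j + 1) ≤ Stirling.stirlingSeq 1 :=
    Stirling.stirlingSeq'_antitone (Nat.zero_le j)
  rw [Stirling.stirlingSeq_one, Stirling.stirlingSeq, div_le_iff₀ (by positivity)] at h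
  refine h.trans_eq ?_
  rw [Real.sqrt_mul (by norm_num)]
  field_simp

/-- A quadratic lower bound for the Poisson-type weight `e^(k-x) (x/k)^k`, with the
denominator cleared. -/
theorem exp_neg_sq_div_mul_pow_le {x : ℝ} (hx : 0 < x) {k : ℕ} (hk : k ≠ 0) :
    Real.exp (-(x - k) ^ 2 / x) * (k : ℝ) ^ k ≤ Real.exp (k - x) * x ^ k := by
  have hk' : (0 : ℝ) < k := by positivity
  have h : (k : ℝ) * Real.exp (1 - k / x) ≤ x := by
    have hlog := Real.one_sub_inv_le_log_of_pos (div_pos hx hk')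
    rw [inv_div, Real.le_log_iff_exp_le (div_pos hx hk'), le_div_iff₀ hk'] at hlog
    linarith
  calc Real.exp (-(x - k) ^ 2 / x) * (k : ℝ) ^ k
      = Real.exp (k - x) * ((k : ℝ) * Real.exp (1 - k / x)) ^ k := by
        rw [mul_pow, ← Real.exp_nat_mul, mul_left_comm, ← Real.exp_add, mul_comm]
        congr 2
        field_simp
        ring
    _ ≤ Real.exp (k - x) * x ^ k := by gcongr

/-- `√(2π)/e` exceeds `1/2`. -/
theorem half_le_sqrt_two_pi_div_exp_one :
    (1 : ℝ) / 2 ≤ Real.sqrt (2 * Real.pi) / Real.exp 1 := by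
  rw [le_div_iff₀ (Real.exp_pos 1)]
  apply Real.le_sqrt_of_sq_le
  nlinarith [Real.exp_one_lt_d9, Real.exp_pos 1, Real.pi_gt_three]

/-- For `n ≥ 1`, `0 < a ≤ √n/6` and `0 ≤ m ≤ n` with `|m - n/2| ≤ a√n`,
the `Binomial(n,1/2)` mass at `m` is at least `(√(2π)/e) e^(-3a²)` times the `Poisson(n/2)`
mass at `m`; in particular at least `(1/2) e^(-3a²)` times it. -/
theorem binomial_ge_poisson (n m : ℕ) (hn : 1 ≤ n) (a : ℝ) (ha : 0 < a)
    (ha' : a ≤ Real.sqrt n / 6) (hm : m ≤ n) (hmid : |(m : ℝ) - (n : ℝ) / 2| ≤ a * Real.sqrt n) :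
    Real.sqrt (2 * Real.pi) / Real.exp 1 * Real.exp (-3 * a ^ 2) *
        (Real.exp (-(n : ℝ) / 2) * ((n : ℝ) / 2) ^ m / (m.factorial : ℝ))
      ≤ (n.choose m : ℝ) / 2 ^ n ∧
    1 / 2 * Real.exp (-3 * a ^ 2) *
        (Real.exp (-(n : ℝ) / 2) * ((n : ℝ) / 2) ^ m / (m.factorial : ℝ))
      ≤ (n.choose m : ℝ) / 2 ^ n := by
  obtain ⟨k, rfl⟩ := Nat.exists_eq_add_of_le hm
  set n := m + k with hndef
  have hn0 : (0 : ℝ) < n := by exact_mod_cast hn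
  have hnk : (n : ℝ) = m + k := by simp [hndef]
  have hk : k ≠ 0 := by
    rintro rfl
    have hle := (abs_le.1 hmid).2
    have hmul := mul_le_mul_of_nonneg_right ha' (Real.sqrt_nonneg n)
    rw [div_mul_eq_mul_div, Real.mul_self_sqrt hn0.le] at hmul
    push_cast at hnk
    linarith
  have hsq : ((n : ℝ) / 2 - k) ^ 2 ≤ a ^ 2 * n := by
    have h := pow_le_pow_left₀ (abs_nonneg _) hmid 2
    rw [sq_abs, mul_pow, Real.sq_sqrt hn0.le] at h
    rw [show (n : ℝ) / 2 - k = m - n / 2 by rw [hnk]; ring]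
    exact h
  have hexp : Real.exp (-3 * a ^ 2) * (k : ℝ) ^ k
      ≤ Real.exp (k - n / 2) * ((n : ℝ) / 2) ^ k := by
    refine le_trans ?_ (exp_neg_sq_div_mul_pow_le (half_pos hn0) hk)
    gcongr
    rw [le_div_iff₀ (half_pos hn0)]
    nlinarith [mul_nonneg (sq_nonneg a) hn0.le]
  have hmain : Real.sqrt (2 * Real.pi) / Real.exp 1 * Real.exp (-3 * a ^ 2) *
      (Real.exp (-(n : ℝ) / 2) * ((n : ℝ) / 2) ^ m) * k.factorial * 2 ^ n
      ≤ n.factorial := by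
    calc _ ≤ Real.sqrt (2 * Real.pi) / Real.exp 1 * Real.exp (-3 * a ^ 2) *
          (Real.exp (-(n : ℝ) / 2) * ((n : ℝ) / 2) ^ m) *
          (Real.exp 1 * Real.sqrt k * (k / Real.exp 1) ^ k) * 2 ^ n := by
          gcongr
          exact factorial_le_exp_one_mul_sqrt_mul_pow hk
      _ = Real.sqrt (2 * Real.pi) * Real.sqrt k * Real.exp (-(n : ℝ) / 2) *
          ((n : ℝ) / 2) ^ m * 2 ^ n / Real.exp 1 ^ k *
          (Real.exp (-3 * a ^ 2) * (k : ℝ) ^ k) := by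
          rw [div_pow (k : ℝ)]
          field_simp
      _ ≤ Real.sqrt (2 * Real.pi) * Real.sqrt n * Real.exp (-(n : ℝ) / 2) *
          ((n : ℝ) / 2) ^ m * 2 ^ n / Real.exp 1 ^ k *
          (Real.exp (k - n / 2) * ((n : ℝ) / 2) ^ k) := by
          gcongr
          exact hndef ▸ Nat.le_add_left k m
      _ = Real.sqrt (2 * Real.pi * n) * (n / Real.exp 1) ^ n := by
          have hE : Real.exp (-(n : ℝ) / 2) * Real.exp (k - n / 2) * Real.exp 1 ^ n
              = Real.exp 1 ^ k := by
            simp only [← Real.exp_nat_mul, ← Real.exp_add]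
            congr 1
            ring
          have hP : ((n : ℝ) / 2) ^ m * ((n : ℝ) / 2) ^ k * 2 ^ n = (n : ℝ) ^ n := by
            rw [← pow_add, ← hndef, ← mul_pow]
            congr 1
            ring
          rw [Real.sqrt_mul (by positivity : (0 : ℝ) ≤ 2 * Real.pi), div_pow (n : ℝ) (Real.exp 1),
            ← hP, ← hE]
          generalize ((n : ℝ) / 2) ^ m = p, ((n : ℝ) / 2) ^ k = q
          field_simp
      _ ≤ n.factorial := Stirling.le_factorial_stirling n
  have hfirst : Real.sqrt (2 * Real.pi) / Real.exp 1 * Real.exp (-3 * a ^ 2) *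
      (Real.exp (-(n : ℝ) / 2) * ((n : ℝ) / 2) ^ m / (m.factorial : ℝ))
      ≤ (n.choose m : ℝ) / 2 ^ n := by
    rw [Nat.cast_choose ℝ hm, show n - m = k by omega, div_div, ← mul_div_assoc,
      div_le_div_iff₀ (by positivity) (by positivity)]
    calc _ = _ := by ring
      _ ≤ _ := mul_le_mul_of_nonneg_right hmain (Nat.cast_nonneg m.factorial)
  refine ⟨hfirst, le_trans ?_ hfirst⟩
  refine mul_le_mul_of_nonneg_right (mul_le_mul_of_nonneg_right ?_ (by positivity)) (by positivity)
  exact half_le_sqrt_two_pi_div_exp_one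
end
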